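/- Assume ‖v_i‖ ≤ 1 for all i, the Gram matrix K is positive definite, λ̂_r > 0, and the normalized eigengap satisfies Δ = (λ_r − λ_{r+1})/N > 3 ‖L_N − L_m‖_HS. Then ‖K_r − K̂_r‖_F ≤ 4N‖L_N − L_m‖_HS / (Δ − ‖L_N − L_m‖_HS) ≤ 6N‖L_N − L_m‖_HS / Δ. -/

import Mathlib

open Matrix
open scoped RealInnerProductSpace

/-- The Hilbert–Schmidt norm of an operator `L` on a real Hilbert space, computed in the
orthonormal basis `b` (the ℓ² norm of the matrix of `L` in any orthonormal basis). -/
noncomputable def hsNorm {H : Type*} [NormedAddCommGroup H] [InnerProductSpace ℝ H]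
    {ι : Type*} (b : HilbertBasis ι ℝ H) (L : H →L[ℝ] H) : ℝ :=
  Real.sqrt (∑' p : ι × ι, (⟪b p.1, L (b p.2)⟫ : ℝ) ^ 2)

/-- The Frobenius norm of a real matrix. -/
noncomputable def frobNorm {p q : Type*} [Fintype p] [Fintype q] (A : Matrix p q ℝ) : ℝ :=
  Real.sqrt (∑ i, ∑ j, (A i j) ^ 2)

/-- The empirical integral operator `f ↦ (1/n) Σ_i ⟨v_i, f⟩ v_i`. -/
noncomputable def integralOp {H : Type*} [NormedAddCommGroup H] [InnerProductSpace ℝ H]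
    {n : ℕ} (v : Fin n → H) : H →L[ℝ] H :=
  (n : ℝ)⁻¹ • ∑ i, (innerSL ℝ (v i)).smulRight (v i)

/-- The normalized eigenfunction `φ_j = λ_j^{-1/2} Σ_i V_{i,j} v_i` (also used for the
subsampled eigenfunctions `φ̂_j = λ̂_j^{-1/2} Σ_i U_{i,j} ŵ_i`). -/
noncomputable def phiVec {H : Type*} [NormedAddCommGroup H] [InnerProductSpace ℝ H]
    {n : ℕ} (v : Fin n → H) (lam : Fin n → ℝ) (V : Matrix (Fin n) (Fin n) ℝ)
    (j : Fin n) : H :=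
  (Real.sqrt (lam j))⁻¹ • ∑ i, V i j • v i

/-- The matrix `W = Σ_{k=1}^r λ_k⁻¹ V_{·,k} V_{·,k}ᵀ` (also used for `Ŵ`). -/
noncomputable def rankW {n : ℕ} (lam : Fin n → ℝ) (V : Matrix (Fin n) (Fin n) ℝ) (r : ℕ) :
    Matrix (Fin n) (Fin n) ℝ :=
  Matrix.of fun i j =>
    ∑ k ∈ Finset.univ.filter (fun k : Fin n => (k : ℕ) < r), (lam k)⁻¹ * V i k * V j k

section DavisKahan

variable {H : Type*} [NormedAddCommGroup H] [InnerProductSpace ℝ H] {r : ℕ}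

/-- The component of `x` orthogonal to the orthonormal family `ψ`. -/
noncomputable def orthoResidual (ψ : Fin r → H) (x : H) : H :=
  x - ∑ k, ⟪ψ k, x⟫ • ψ k

theorem inner_orthoResidual_eq_zero {ψ : Fin r → H} (hψ : Orthonormal ℝ ψ) (x : H) (k : Fin r) :
    ⟪ψ k, orthoResidual ψ x⟫ = 0 := by
  rw [orthoResidual, inner_sub_right, hψ.inner_right_fintype, sub_self]

theorem norm_orthoResidual_sq {ψ : Fin r → H} (hψ : Orthonormal ℝ ψ) (x : H) :
    ‖orthoResidual ψ x‖ ^ 2 = ‖x‖ ^ 2 - ∑ k, ⟪ψ k, x⟫ ^ 2 := by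
  have h : ⟪orthoResidual ψ x, orthoResidual ψ x⟫ = ⟪x, orthoResidual ψ x⟫ := by
    nth_rewrite 1 [orthoResidual]
    simp [inner_sub_left, sum_inner, inner_smul_left, inner_orthoResidual_eq_zero hψ]
  rw [← real_inner_self_eq_norm_sq, h, orthoResidual, inner_sub_right,
    real_inner_self_eq_norm_sq, inner_sum]
  congr 1
  refine Finset.sum_congr rfl fun k _ => ?_
  rw [inner_smul_right, real_inner_comm x, sq]

theorem sum_norm_orthoResidual_comm {φ ψ : Fin r → H} (hφ : Orthonormal ℝ φ)
    (hψ : Orthonormal ℝ ψ) :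
    ∑ k, ‖orthoResidual φ (ψ k)‖ ^ 2 = ∑ j, ‖orthoResidual ψ (φ j)‖ ^ 2 := by
  simp only [norm_orthoResidual_sq hφ, norm_orthoResidual_sq hψ, hφ.norm_eq_one, hψ.norm_eq_one,
    Finset.sum_sub_distrib]
  rw [Finset.sum_comm]
  simp only [real_inner_comm]

theorem sum_inner_sq_le {φ : Fin r → H} (hφ : Orthonormal ℝ φ) (x : H) :
    ∑ j, ⟪φ j, x⟫ ^ 2 ≤ ‖x‖ ^ 2 := by
  have h := norm_orthoResidual_sq hφ x
  nlinarith [sq_nonneg ‖orthoResidual φ x‖]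

theorem abs_sum_inner_mul_inner_le {φ : Fin r → H} (hφ : Orthonormal ℝ φ) (y : Fin r → H)
    {x u : H} (hx : ‖x‖ ≤ 1) (hu : ‖u‖ ≤ 1) :
    |∑ j, ⟪x, y j⟫ * ⟪φ j, u⟫| ≤ Real.sqrt (∑ j, ‖y j‖ ^ 2) := by
  refine Real.abs_le_sqrt ((Finset.sum_mul_sq_le_sq_mul_sq _ _ _).trans ?_)
  have h1 : ∑ j, ⟪x, y j⟫ ^ 2 ≤ ∑ j, ‖y j‖ ^ 2 := by
    refine Finset.sum_le_sum fun j _ => ?_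
    refine sq_le_sq.mpr ((abs_real_inner_le_norm x (y j)).trans ?_)
    rw [abs_of_nonneg (norm_nonneg _)]
    exact mul_le_of_le_one_left (norm_nonneg _) hx
  have h2 : ∑ j, ⟪φ j, u⟫ ^ 2 ≤ 1 :=
    (sum_inner_sq_le hφ u).trans (pow_le_one₀ (norm_nonneg _) hu)
  calc _ ≤ (∑ j, ‖y j‖ ^ 2) * 1 :=
        mul_le_mul h1 h2 (Finset.sum_nonneg fun _ _ => sq_nonneg _)
          (Finset.sum_nonneg fun _ _ => sq_nonneg _)
    _ = _ := mul_one _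

/-- The bilinear form of the difference of two orthogonal projections of equal rank is
bounded by twice the Hilbert–Schmidt distance between their ranges. -/
theorem abs_sub_projection_form_le {φ ψ : Fin r → H} (hφ : Orthonormal ℝ φ)
    (hψ : Orthonormal ℝ ψ) {x u : H} (hx : ‖x‖ ≤ 1) (hu : ‖u‖ ≤ 1) :
    |∑ j, ⟪x, φ j⟫ * ⟪φ j, u⟫ - ∑ k, ⟪x, ψ k⟫ * ⟪ψ k, u⟫| ≤
      2 * Real.sqrt (∑ j, ‖orthoResidual ψ (φ j)‖ ^ 2) := by
  have h1 := abs_sum_inner_mul_inner_le hφ (fun j => orthoResidual ψ (φ j)) hx hu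
  have h2 := abs_sum_inner_mul_inner_le hψ (fun k => orthoResidual φ (ψ k)) hu hx
  rw [sum_norm_orthoResidual_comm hφ hψ] at h2
  have hsplit : ∑ j, ⟪x, φ j⟫ * ⟪φ j, u⟫ - ∑ k, ⟪x, ψ k⟫ * ⟪ψ k, u⟫ =
      ∑ j, ⟪x, orthoResidual ψ (φ j)⟫ * ⟪φ j, u⟫ -
        ∑ k, ⟪u, orthoResidual φ (ψ k)⟫ * ⟪ψ k, x⟫ := by
    simp only [orthoResidual, inner_sub_right, inner_sum, inner_smul_right, sub_mul,
      Finset.sum_sub_distrib, Finset.sum_mul]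
    rw [Finset.sum_comm (f := fun k j => ⟪φ j, ψ k⟫ * ⟪u, φ j⟫ * ⟪ψ k, x⟫)]
    have e1 : ∑ k, ⟪u, ψ k⟫ * ⟪ψ k, x⟫ = ∑ k, ⟪x, ψ k⟫ * ⟪ψ k, u⟫ :=
      Finset.sum_congr rfl fun k _ => by
        rw [real_inner_comm u, real_inner_comm x, mul_comm]
    have e2 : ∑ j, ∑ k, ⟪φ j, ψ k⟫ * ⟪u, φ j⟫ * ⟪ψ k, x⟫ =
        ∑ j, ∑ k, ⟪ψ k, φ j⟫ * ⟪x, ψ k⟫ * ⟪φ j, u⟫ :=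
      Finset.sum_congr rfl fun j _ => Finset.sum_congr rfl fun k _ => by
        rw [real_inner_comm (φ j) (ψ k), real_inner_comm u, real_inner_comm x (ψ k)]
        ring
    rw [e1, e2]
    ring
  rw [hsplit]
  refine (abs_sub _ _).trans ?_
  linarith

/-- A Weyl-type inequality for the quadratic form of `B` on the complement of its leading
eigenspace. -/
theorem inner_apply_le_of_perturbation {A B : H →L[ℝ] H} {φ ψ : Fin r → H}
    (hψ : Orthonormal ℝ ψ) (hB : ∀ x y, ⟪B x, y⟫ = ⟪x, B y⟫)
    {ν : Fin r → ℝ} (hν : ∀ k, B (ψ k) = ν k • ψ k) {γ β ε : ℝ} (hγ : ∀ k, γ ≤ ν k)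
    (hBψ : ∀ x, (∀ k, ⟪ψ k, x⟫ = 0) → ⟪x, B x⟫ ≤ γ * ‖x‖ ^ 2)
    (hAφ : ∀ x, (∀ j, ⟪φ j, x⟫ = 0) → ⟪x, A x⟫ ≤ β * ‖x‖ ^ 2)
    (hε : ∀ x, ‖(A - B) x‖ ≤ ε * ‖x‖)
    {x : H} (hx : ∀ k, ⟪ψ k, x⟫ = 0) :
    ⟪x, B x⟫ ≤ (β + ε) * ‖x‖ ^ 2 := by
  by_cases hx0 : x = 0
  · simp [hx0]
  have hxpos : 0 < ‖x‖ ^ 2 := by positivity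
  let T : ((Fin r → ℝ) × ℝ) →ₗ[ℝ] (Fin r → ℝ) :=
    { toFun := fun c j => ⟪φ j, ∑ k, c.1 k • ψ k + c.2 • x⟫
      map_add' := fun c d => by
        ext j
        simp only [Prod.fst_add, Prod.snd_add, Pi.add_apply, add_smul, Finset.sum_add_distrib,
          inner_add_right]
        ring
      map_smul' := fun a c => by
        ext j
        simp only [Prod.smul_fst, Prod.smul_snd, Pi.smul_apply, smul_eq_mul, mul_smul,
          ← Finset.smul_sum, ← smul_add, inner_smul_right, RingHom.id_apply] }
  have hker : LinearMap.ker T ≠ ⊥ := LinearMap.ker_ne_bot_of_finrank_lt (by simp)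
  obtain ⟨⟨c, t⟩, hcT, hc0⟩ := (Submodule.ne_bot_iff _).mp hker
  set p := ∑ k, c k • ψ k with hp
  have hortho : ∀ j, ⟪φ j, p + t • x⟫ = 0 := fun j => congrFun hcT j
  have hBp : B p = ∑ k, (c k * ν k) • ψ k := by
    simp [hp, map_sum, hν, smul_smul]
  have hpx : ⟪p, x⟫ = 0 := by simp [hp, sum_inner, inner_smul_left, hx]
  have hBpx : ⟪B p, x⟫ = 0 := by simp [hBp, sum_inner, inner_smul_left, hx]
  have hpn : ‖p‖ ^ 2 = ∑ k, c k ^ 2 := by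
    rw [← real_inner_self_eq_norm_sq, hp, hψ.inner_sum]
    simp [sq]
  have hpB : ⟪p, B p⟫ = ∑ k, ν k * c k ^ 2 := by
    rw [hBp, hp, hψ.inner_sum]
    exact Finset.sum_congr rfl fun k _ => by simp; ring
  have hpB' : γ * ‖p‖ ^ 2 ≤ ⟪p, B p⟫ := by
    rw [hpn, hpB, Finset.mul_sum]
    exact Finset.sum_le_sum fun k _ => mul_le_mul_of_nonneg_right (hγ k) (sq_nonneg _)
  have hyn : ‖p + t • x‖ ^ 2 = ‖p‖ ^ 2 + t ^ 2 * ‖x‖ ^ 2 := by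
    rw [norm_add_sq_real, inner_smul_right, hpx, norm_smul, mul_pow, Real.norm_eq_abs, sq_abs]
    ring
  have hyB : ⟪p + t • x, B (p + t • x)⟫ = ⟪p, B p⟫ + t ^ 2 * ⟪x, B x⟫ := by
    rw [map_add, map_smul, inner_add_left, inner_add_right, inner_add_right, inner_smul_left,
      inner_smul_left, inner_smul_right, inner_smul_right, ← hB p x, hBpx,
      real_inner_comm (B p) x, hBpx]
    simp
    ring
  have hypos : 0 < ‖p + t • x‖ ^ 2 := by
    rw [hyn, hpn]
    by_cases ht : t = 0
    · have hcne : c ≠ 0 := fun h => hc0 (by simp [h, ht])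
      obtain ⟨k, hk⟩ := Function.ne_iff.mp hcne
      have : 0 < ∑ k, c k ^ 2 :=
        Finset.sum_pos' (fun _ _ => sq_nonneg _) ⟨k, Finset.mem_univ k, by
          have : c k ≠ 0 := hk
          positivity⟩
      positivity
    · have : 0 ≤ ∑ k, c k ^ 2 := Finset.sum_nonneg fun _ _ => sq_nonneg _
      positivity
  have hE : ⟪p + t • x, B (p + t • x)⟫ ≤ (β + ε) * ‖p + t • x‖ ^ 2 := by
    have h1 := hAφ _ hortho
    have h2 := abs_real_inner_le_norm (p + t • x) ((A - B) (p + t • x))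
    have h3 := mul_le_mul_of_nonneg_left (hε (p + t • x)) (norm_nonneg (p + t • x))
    have h4 := (abs_le.mp (h2.trans h3)).1
    rw [_root_.sub_apply, inner_sub_right] at h4
    nlinarith
  have hBx := hBψ x hx
  set q := ⟪x, B x⟫ / ‖x‖ ^ 2 with hq
  have hqx : ⟪x, B x⟫ = q * ‖x‖ ^ 2 := by rw [hq]; field_simp
  have hqγ : q ≤ γ := by rw [hqx] at hBx; exact le_of_mul_le_mul_right hBx hxpos
  have hqle : q * ‖p + t • x‖ ^ 2 ≤ (β + ε) * ‖p + t • x‖ ^ 2 := by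
    refine le_trans ?_ hE
    rw [hyB, hyn, hqx]
    nlinarith [mul_le_mul_of_nonneg_right hqγ (sq_nonneg ‖p‖)]
  rw [hqx]
  exact mul_le_mul_of_nonneg_right (le_of_mul_le_mul_right hqle hypos) hxpos.le

/-- A Davis–Kahan bound for leading eigenspaces. -/
theorem sum_norm_orthoResidual_le {A B : H →L[ℝ] H} {φ ψ : Fin r → H}
    (hψ : Orthonormal ℝ ψ) (hB : ∀ x y, ⟪B x, y⟫ = ⟪x, B y⟫)
    {μ ν : Fin r → ℝ} (hμ : ∀ j, A (φ j) = μ j • φ j) (hν : ∀ k, B (ψ k) = ν k • ψ k)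
    {α β γ ε : ℝ} (hα : ∀ j, α ≤ μ j) (hγ : ∀ k, γ ≤ ν k)
    (hBψ : ∀ x, (∀ k, ⟪ψ k, x⟫ = 0) → ⟪x, B x⟫ ≤ γ * ‖x‖ ^ 2)
    (hAφ : ∀ x, (∀ j, ⟪φ j, x⟫ = 0) → ⟪x, A x⟫ ≤ β * ‖x‖ ^ 2)
    (hε : ∀ x, ‖(A - B) x‖ ≤ ε * ‖x‖) (hgap : 0 ≤ α - β - ε) :
    (α - β - ε) ^ 2 * ∑ j, ‖orthoResidual ψ (φ j)‖ ^ 2 ≤ ∑ j, ‖(A - B) (φ j)‖ ^ 2 := by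
  rw [Finset.mul_sum]
  refine Finset.sum_le_sum fun j _ => ?_
  rw [← mul_pow]
  refine pow_le_pow_left₀ (by positivity) ?_ 2
  set x := orthoResidual ψ (φ j) with hxdef
  have hx : ∀ k, ⟪ψ k, x⟫ = 0 := inner_orthoResidual_eq_zero hψ (φ j)
  have hφx : φ j = x + ∑ k, ⟪ψ k, φ j⟫ • ψ k := by rw [hxdef, orthoResidual]; abel
  have hxB : ⟪x, B (φ j)⟫ = ⟪x, B x⟫ := by
    conv_lhs => rw [hφx]
    simp [map_sum, hν, inner_add_right, inner_sum, inner_smul_right, real_inner_comm, hx]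
  have hxφ : ⟪x, φ j⟫ = ‖x‖ ^ 2 := by
    conv_lhs => rw [hφx]
    simp [inner_add_right, inner_sum, inner_smul_right, real_inner_comm, hx]
  have hweyl := inner_apply_le_of_perturbation hψ hB hν hγ hBψ hAφ hε hx
  have hinner : ⟪x, (A - B) (φ j)⟫ = μ j * ‖x‖ ^ 2 - ⟪x, B x⟫ := by
    rw [_root_.sub_apply, inner_sub_right, hxB, hμ, inner_smul_right, hxφ]
  have hle := real_inner_le_norm x ((A - B) (φ j))
  have hαx := mul_le_mul_of_nonneg_right (hα j) (sq_nonneg ‖x‖)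
  rcases (norm_nonneg x).eq_or_lt with h0 | hpos
  · rw [← h0]; simp
  · refine le_of_mul_le_mul_left ?_ hpos
    nlinarith

end DavisKahan

section HilbertSchmidt

variable {H : Type*} [NormedAddCommGroup H] [InnerProductSpace ℝ H] {ι : Type*}

theorem hasSum_inner_sq (b : HilbertBasis ι ℝ H) (x : H) :
    HasSum (fun q => ⟪b q, x⟫ ^ 2) (‖x‖ ^ 2) := by
  have h := b.hasSum_inner_mul_inner x x
  simpa only [real_inner_self_eq_norm_sq, real_inner_comm x, ← sq] using h

theorem hsNorm_sq (b : HilbertBasis ι ℝ H) {L : H →L[ℝ] H}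
    (hL : Summable fun q => ‖L (b q)‖ ^ 2) :
    hsNorm b L ^ 2 = ∑' q, ‖L (b q)‖ ^ 2 := by
  have hs : Summable fun p : ι × ι => ⟪b p.2, L (b p.1)⟫ ^ 2 := by
    refine (summable_prod_of_nonneg fun p => sq_nonneg _).mpr
      ⟨fun q => (hasSum_inner_sq b (L (b q))).summable, ?_⟩
    simpa only [(hasSum_inner_sq b _).tsum_eq] using hL
  rw [hsNorm, Real.sq_sqrt (tsum_nonneg fun _ => sq_nonneg _),
    ← (Equiv.prodComm ι ι).tsum_eq (fun p : ι × ι => ⟪b p.1, L (b p.2)⟫ ^ 2)]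
  refine (hs.tsum_prod).trans ?_
  exact tsum_congr fun q => (hasSum_inner_sq b (L (b q))).tsum_eq

theorem sum_norm_apply_sq_le_hsNorm_sq (b : HilbertBasis ι ℝ H) {L : H →L[ℝ] H}
    (hsymm : ∀ x y, ⟪L x, y⟫ = ⟪x, L y⟫) (hL : Summable fun q => ‖L (b q)‖ ^ 2)
    {r : ℕ} {φ : Fin r → H} (hφ : Orthonormal ℝ φ) :
    ∑ j, ‖L (φ j)‖ ^ 2 ≤ hsNorm b L ^ 2 := by
  rw [hsNorm_sq b hL]
  have h := hasSum_sum fun (j : Fin r) (_ : j ∈ Finset.univ) => hasSum_inner_sq b (L (φ j))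
  refine hasSum_le (fun q => ?_) h hL.hasSum
  refine le_trans (le_of_eq ?_) (sum_inner_sq_le hφ (L (b q)))
  exact Finset.sum_congr rfl fun j _ => by rw [← hsymm, real_inner_comm]

theorem norm_apply_le_hsNorm (b : HilbertBasis ι ℝ H) {L : H →L[ℝ] H}
    (hsymm : ∀ x y, ⟪L x, y⟫ = ⟪x, L y⟫) (hL : Summable fun q => ‖L (b q)‖ ^ 2) (x : H) :
    ‖L x‖ ≤ hsNorm b L * ‖x‖ := by
  by_cases hx : x = 0
  · simp [hx]
  have hxn : ‖x‖ ≠ 0 := norm_ne_zero_iff.mpr hx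
  have hφ : Orthonormal ℝ (fun _ : Fin 1 => ‖x‖⁻¹ • x) :=
    ⟨fun _ => by simp [norm_smul, hxn], fun i j hij => (hij (Subsingleton.elim i j)).elim⟩
  have h := sum_norm_apply_sq_le_hsNorm_sq b hsymm hL hφ
  simp only [Finset.univ_unique, Finset.sum_singleton] at h
  have h' := (pow_le_pow_iff_left₀ (norm_nonneg _) (Real.sqrt_nonneg _) two_ne_zero).mp h
  rw [map_smul, norm_smul, norm_inv, norm_norm, inv_mul_le_iff₀ (by positivity)] at h'
  rwa [mul_comm]

end HilbertSchmidt

section IntegralOperator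

variable {H : Type*} [NormedAddCommGroup H] [InnerProductSpace ℝ H] {n : ℕ}

theorem integralOp_apply (v : Fin n → H) (x : H) :
    integralOp v x = (n : ℝ)⁻¹ • ∑ i, ⟪v i, x⟫ • v i := by
  simp [integralOp]

theorem inner_integralOp (v : Fin n → H) (x y : H) :
    ⟪x, integralOp v y⟫ = (n : ℝ)⁻¹ * ∑ i, ⟪v i, x⟫ * ⟪v i, y⟫ := by
  rw [integralOp_apply, inner_smul_right, inner_sum]
  congr 1
  refine Finset.sum_congr rfl fun i _ => ?_
  rw [inner_smul_right, real_inner_comm (v i) x, mul_comm]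

theorem integralOp_symm (v : Fin n → H) (x y : H) :
    ⟪integralOp v x, y⟫ = ⟪x, integralOp v y⟫ := by
  rw [real_inner_comm, inner_integralOp, inner_integralOp]
  simp only [mul_comm]

theorem summable_norm_integralOp_sq {ι : Type*} (b : HilbertBasis ι ℝ H) (v : Fin n → H) :
    Summable fun q => ‖integralOp v (b q)‖ ^ 2 := by
  have hs : Summable fun q => ((n : ℝ)⁻¹ ^ 2 * ∑ i, ‖v i‖ ^ 2) * ∑ i, ⟪b q, v i⟫ ^ 2 :=
    (summable_sum fun i _ => (hasSum_inner_sq b (v i)).summable).mul_left _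
  refine hs.of_nonneg_of_le (fun _ => sq_nonneg _) fun q => ?_
  rw [integralOp_apply, norm_smul, mul_pow, Real.norm_eq_abs, sq_abs, mul_assoc]
  refine mul_le_mul_of_nonneg_left ?_ (sq_nonneg _)
  rw [mul_comm]
  refine le_trans (pow_le_pow_left₀ (norm_nonneg _) (norm_sum_le _ _) 2) ?_
  simp only [norm_smul]
  refine (Finset.sum_mul_sq_le_sq_mul_sq _ _ _).trans (le_of_eq ?_)
  simp only [Real.norm_eq_abs, sq_abs, real_inner_comm]

theorem summable_norm_integralOp_sub_sq {ι : Type*} (b : HilbertBasis ι ℝ H) {m : ℕ}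
    (v : Fin n → H) (w : Fin m → H) :
    Summable fun q => ‖(integralOp v - integralOp w) (b q)‖ ^ 2 := by
  refine (((summable_norm_integralOp_sq b v).add
    (summable_norm_integralOp_sq b w)).mul_left 2).of_nonneg_of_le (fun _ => sq_nonneg _)
      fun q => ?_
  rw [_root_.sub_apply]
  refine le_trans (pow_le_pow_left₀ (norm_nonneg _) (norm_sub_le _ _) 2) ?_
  exact add_sq_le

variable {v : Fin n → H} {K V : Matrix (Fin n) (Fin n) ℝ} {lam : Fin n → ℝ}

theorem inner_sum_smul_of_eigen (hK : ∀ i j, K i j = ⟪v i, v j⟫)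
    (heig : ∀ j, K.mulVec (fun i => V i j) = lam j • (fun i => V i j)) (i j : Fin n) :
    ⟪v i, ∑ a, V a j • v a⟫ = lam j * V i j := by
  have h := congrFun (heig j) i
  simp only [mulVec, dotProduct, Pi.smul_apply, smul_eq_mul] at h
  rw [← h, inner_sum]
  exact Finset.sum_congr rfl fun a _ => by rw [inner_smul_right, hK, mul_comm]

theorem sum_mul_of_transpose_mul_eq_one (hV : Vᵀ * V = 1) (j k : Fin n) :
    ∑ i, V i j * V i k = if j = k then 1 else 0 := by
  have h := congrFun (congrFun hV j) k
  simpa [mul_apply, one_apply] using h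

theorem inner_sum_smul_sum_smul (hK : ∀ i j, K i j = ⟪v i, v j⟫) (hV : Vᵀ * V = 1)
    (heig : ∀ j, K.mulVec (fun i => V i j) = lam j • (fun i => V i j)) (j k : Fin n) :
    ⟪∑ a, V a j • v a, ∑ a, V a k • v a⟫ = if j = k then lam j else 0 := by
  rw [sum_inner]
  simp only [inner_smul_left, inner_sum_smul_of_eigen hK heig, RCLike.conj_to_real]
  have h := sum_mul_of_transpose_mul_eq_one hV j k
  calc _ = lam k * ∑ i, V i j * V i k := by
        rw [Finset.mul_sum]; exact Finset.sum_congr rfl fun i _ => by ring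
    _ = _ := by
        rw [h]; split_ifs with hjk <;> simp [hjk]

theorem eigenvalue_nonneg (hK : ∀ i j, K i j = ⟪v i, v j⟫) (hV : Vᵀ * V = 1)
    (heig : ∀ j, K.mulVec (fun i => V i j) = lam j • (fun i => V i j)) (j : Fin n) :
    0 ≤ lam j := by
  have h := inner_sum_smul_sum_smul hK hV heig j j
  rw [if_pos rfl, real_inner_self_eq_norm_sq] at h
  exact h ▸ sq_nonneg _

theorem phiVec_orthonormal (hK : ∀ i j, K i j = ⟪v i, v j⟫) (hV : Vᵀ * V = 1)
    (heig : ∀ j, K.mulVec (fun i => V i j) = lam j • (fun i => V i j))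
    {r : ℕ} (hr : r ≤ n) (hpos : ∀ j : Fin r, 0 < lam (Fin.castLE hr j)) :
    Orthonormal ℝ fun j : Fin r => phiVec v lam V (Fin.castLE hr j) := by
  rw [orthonormal_iff_ite]
  intro j k
  simp only [phiVec, inner_smul_left, inner_smul_right, inner_sum_smul_sum_smul hK hV heig,
    RCLike.conj_to_real, (Fin.castLE_injective hr).eq_iff]
  split_ifs with hjk
  · subst hjk
    have h := Real.mul_self_sqrt (hpos j).le
    have h0 := (Real.sqrt_pos.mpr (hpos j)).ne'
    field_simp
    rw [sq, h]
  · simp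

theorem integralOp_phiVec (hK : ∀ i j, K i j = ⟪v i, v j⟫)
    (heig : ∀ j, K.mulVec (fun i => V i j) = lam j • (fun i => V i j)) (j : Fin n) :
    integralOp v (phiVec v lam V j) = (lam j / n) • phiVec v lam V j := by
  simp only [integralOp_apply, phiVec, inner_smul_right _ (∑ i, V i j • v i),
    inner_sum_smul_of_eigen hK heig]
  simp only [Finset.smul_sum, smul_smul]
  exact Finset.sum_congr rfl fun i _ => by congr 1; ring

/-- Parseval's identity in the eigenvector basis of the Gram matrix. -/
theorem sum_inner_sum_smul_sq (v : Fin n → H) (hV : Vᵀ * V = 1) (x : H) :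
    ∑ k, ⟪∑ a, V a k • v a, x⟫ ^ 2 = ∑ i, ⟪v i, x⟫ ^ 2 := by
  have hV' : V * Vᵀ = 1 := mul_eq_one_comm.mp hV
  have h : ∀ k, ⟪∑ a, V a k • v a, x⟫ = (Vᵀ *ᵥ fun i => ⟪v i, x⟫) k := fun k => by
    simp [sum_inner, inner_smul_left, mulVec, dotProduct]
  have h2 : (Vᵀ *ᵥ fun i => ⟪v i, x⟫) ⬝ᵥ (Vᵀ *ᵥ fun i => ⟪v i, x⟫) =
      (fun i => ⟪v i, x⟫) ⬝ᵥ fun i => ⟪v i, x⟫ := by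
    rw [dotProduct_mulVec, vecMul_transpose, mulVec_mulVec, hV', one_mulVec]
  simp only [h]
  simpa only [dotProduct, ← sq] using h2

theorem inner_integralOp_le_of_orthogonal (hK : ∀ i j, K i j = ⟪v i, v j⟫) (hV : Vᵀ * V = 1)
    (heig : ∀ j, K.mulVec (fun i => V i j) = lam j • (fun i => V i j))
    {r : ℕ} (hr : r ≤ n) (hpos : ∀ j : Fin r, 0 < lam (Fin.castLE hr j))
    {c : ℝ} (hlam : ∀ k : Fin n, r ≤ k → lam k ≤ c) (hc : 0 ≤ c)
    {x : H} (hx : ∀ j : Fin r, ⟪phiVec v lam V (Fin.castLE hr j), x⟫ = 0) :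
    ⟪x, integralOp v x⟫ ≤ c / n * ‖x‖ ^ 2 := by
  set g : Fin n → H := fun k => ∑ a, V a k • v a with hg
  have hgx : ∀ k : Fin n, (k : ℕ) < r → ⟪g k, x⟫ = 0 := fun k hk => by
    have h := hx ⟨k, hk⟩
    rw [phiVec, inner_smul_left] at h
    exact (mul_eq_zero.mp h).resolve_left
      (by simpa using (Real.sqrt_pos.mpr (hpos ⟨k, hk⟩)).ne')
  set S := ∑ k, ⟪g k, x⟫ ^ 2 with hS
  have hS0 : 0 ≤ S := Finset.sum_nonneg fun _ _ => sq_nonneg _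
  have hSx : ⟪∑ k, ⟪g k, x⟫ • g k, x⟫ = S := by
    simp [sum_inner, inner_smul_left, hS, sq]
  have hSn : ‖∑ k, ⟪g k, x⟫ • g k‖ ^ 2 ≤ c * S := by
    rw [← real_inner_self_eq_norm_sq, sum_inner, hS, Finset.mul_sum]
    refine Finset.sum_le_sum fun k _ => ?_
    have hk : ⟪⟪g k, x⟫ • g k, ∑ l, ⟪g l, x⟫ • g l⟫ = lam k * ⟪g k, x⟫ ^ 2 := by
      have hgg : ∀ l, ⟪g k, g l⟫ = if k = l then lam k else 0 :=
        inner_sum_smul_sum_smul hK hV heig k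
      simp only [inner_smul_left, inner_sum, inner_smul_right, hgg, RCLike.conj_to_real, mul_ite,
        mul_zero, Finset.sum_ite_eq, Finset.mem_univ, if_true]
      ring
    rw [hk]
    by_cases hkr : (k : ℕ) < r
    · simp [hgx k hkr]
    · exact mul_le_mul_of_nonneg_right (hlam k (not_lt.mp hkr)) (sq_nonneg _)
  have hSle : S ≤ c * ‖x‖ ^ 2 := by
    rcases hS0.eq_or_lt with h0 | hSpos
    · rw [← h0]; positivity
    · refine le_of_mul_le_mul_left ?_ hSpos
      have h := abs_real_inner_le_norm (∑ k, ⟪g k, x⟫ • g k) x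
      rw [hSx, abs_of_nonneg hS0] at h
      calc S * S ≤ (‖∑ k, ⟪g k, x⟫ • g k‖ * ‖x‖) * (‖∑ k, ⟪g k, x⟫ • g k‖ * ‖x‖) :=
            mul_le_mul h h hS0 (by positivity)
        _ = ‖∑ k, ⟪g k, x⟫ • g k‖ ^ 2 * ‖x‖ ^ 2 := by ring
        _ ≤ (c * S) * ‖x‖ ^ 2 := mul_le_mul_of_nonneg_right hSn (sq_nonneg _)
        _ = S * (c * ‖x‖ ^ 2) := by ring
  rw [inner_integralOp]
  simp only [← sq]
  rw [← sum_inner_sum_smul_sq v hV x]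
  calc (n : ℝ)⁻¹ * S ≤ (n : ℝ)⁻¹ * (c * ‖x‖ ^ 2) :=
        mul_le_mul_of_nonneg_left hSle (by positivity)
    _ = _ := by ring

theorem mul_rankW_mul_transpose_apply (lam : Fin n → ℝ) (V : Matrix (Fin n) (Fin n) ℝ)
    {N r : ℕ} (hr : r ≤ n) (hpos : ∀ j : Fin r, 0 < lam (Fin.castLE hr j))
    (z : Fin N → H) (w : Fin n → H) {C : Matrix (Fin N) (Fin n) ℝ}
    (hC : ∀ i a, C i a = ⟪z i, w a⟫) (i j : Fin N) :
    (C * rankW lam V r * Cᵀ) i j =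
      ∑ k : Fin r, ⟪z i, phiVec w lam V (Fin.castLE hr k)⟫ *
        ⟪phiVec w lam V (Fin.castLE hr k), z j⟫ := by
  have hsum : ∀ f : Fin n → ℝ, ∑ k ∈ Finset.univ.filter (fun k : Fin n => (k : ℕ) < r), f k =
      ∑ k : Fin r, f (Fin.castLE hr k) := fun f => by
    symm
    refine Finset.sum_bij (fun k _ => Fin.castLE hr k) (by simp)
      (fun a _ b _ h => Fin.castLE_injective hr h)
      (fun k hk => ⟨⟨k, (Finset.mem_filter.mp hk).2⟩, Finset.mem_univ _, rfl⟩) (by simp)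
  have hφ : ∀ (l : Fin N) (k : Fin n), ⟪z l, phiVec w lam V k⟫ =
      (Real.sqrt (lam k))⁻¹ * ∑ a, C l a * V a k := fun l k => by
    rw [phiVec, inner_smul_right, inner_sum]
    congr 1
    exact Finset.sum_congr rfl fun a _ => by rw [inner_smul_right, hC, mul_comm]
  have hterm : ∀ k : Fin r, ⟪z i, phiVec w lam V (Fin.castLE hr k)⟫ *
      ⟪phiVec w lam V (Fin.castLE hr k), z j⟫ =
      (lam (Fin.castLE hr k))⁻¹ * (∑ a, C i a * V a (Fin.castLE hr k)) *
        ∑ a, C j a * V a (Fin.castLE hr k) := fun k => by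
    rw [real_inner_comm (z j), hφ, hφ, ← Real.mul_self_sqrt (hpos k).le, mul_inv]
    simp only [Real.mul_self_sqrt (hpos k).le]
    ring
  rw [Finset.sum_congr rfl fun k _ => hterm k, ← hsum fun k =>
    (lam k)⁻¹ * (∑ a, C i a * V a k) * ∑ a, C j a * V a k]
  simp only [mul_apply, rankW, of_apply, transpose_apply, Finset.sum_mul, Finset.mul_sum]
  simp only [Finset.sum_comm (s := Finset.univ.filter fun k : Fin n => (k : ℕ) < r)]
  refine Finset.sum_congr rfl fun a _ => ?_
  refine Finset.sum_congr rfl fun c _ => ?_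
  exact Finset.sum_congr rfl fun k _ => by ring

end IntegralOperator

theorem frobNorm_le_of_abs_le {N : ℕ} {A : Matrix (Fin N) (Fin N) ℝ} {c : ℝ} (hc : 0 ≤ c)
    (h : ∀ i j, |A i j| ≤ c) : frobNorm A ≤ N * c := by
  refine Real.sqrt_le_iff.mpr ⟨by positivity, ?_⟩
  calc ∑ i, ∑ j, A i j ^ 2 ≤ ∑ _i : Fin N, ∑ _j : Fin N, c ^ 2 :=
        Finset.sum_le_sum fun i _ => Finset.sum_le_sum fun j _ =>
          sq_le_sq.mpr ((h i j).trans (le_abs_self c))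
    _ = (N * c) ^ 2 := by simp; ring

/-- if `‖v_i‖ ≤ 1`, `K` is positive definite, `λ̂_r > 0` and the normalized
eigengap `Δ = (λ_r − λ_{r+1})/N` exceeds `3‖L_N − L_m‖_HS`, then
`‖K_r − K̂_r‖_F ≤ 4N‖L_N − L_m‖_HS/(Δ − ‖L_N − L_m‖_HS) ≤ 6N‖L_N − L_m‖_HS/Δ`. -/
theorem nystrom_frobenius_error_bound
    {H : Type*} [NormedAddCommGroup H] [InnerProductSpace ℝ H]
    {ι : Type*} (b : HilbertBasis ι ℝ H)
    (N m r : ℕ) (hm : 0 < m) (hr1 : 1 ≤ r) (hrN : r < N) (hrm : r ≤ m)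
    (v : Fin N → H) (hv : ∀ i, ‖v i‖ ≤ 1)
    (K : Matrix (Fin N) (Fin N) ℝ) (hK : ∀ i j, K i j = ⟪v i, v j⟫)
    (hKpd : K.PosDef)
    (lam : Fin N → ℝ) (hdesc : ∀ i j : Fin N, i ≤ j → lam j ≤ lam i)
    (V : Matrix (Fin N) (Fin N) ℝ) (hV : Vᵀ * V = 1)
    (heig : ∀ j, K.mulVec (fun i => V i j) = lam j • (fun i => V i j))
    (w : Fin m → H) (hw : ∀ a, ∃ i, w a = v i)
    (Khat : Matrix (Fin m) (Fin m) ℝ) (hKhat : ∀ a b, Khat a b = ⟪w a, w b⟫)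
    (lamh : Fin m → ℝ) (hdesch : ∀ a b : Fin m, a ≤ b → lamh b ≤ lamh a)
    (U : Matrix (Fin m) (Fin m) ℝ) (hU : Uᵀ * U = 1)
    (heigh : ∀ j, Khat.mulVec (fun i => U i j) = lamh j • (fun i => U i j))
    (hlamh : 0 < lamh ⟨r - 1, by omega⟩)
    (ε : ℝ) (hε : ε = hsNorm b (integralOp v - integralOp w))
    (Δ : ℝ) (hΔ : Δ = (lam ⟨r - 1, by omega⟩ - lam ⟨r, hrN⟩) / N)
    (hgap : Δ > 3 * ε)
    (Kb : Matrix (Fin N) (Fin m) ℝ) (hKb : ∀ i a, Kb i a = ⟪v i, w a⟫) :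
    frobNorm (K * rankW lam V r * K - Kb * rankW lamh U r * Kbᵀ) ≤ 4 * N * ε / (Δ - ε) ∧
      4 * N * ε / (Δ - ε) ≤ 6 * N * ε / Δ := by
  have hNpos : (0 : ℝ) < N := by exact_mod_cast (by omega : 0 < N)
  have hε0 : 0 ≤ ε := hε ▸ Real.sqrt_nonneg _
  have hΔ0 : 0 < Δ := by linarith
  have hgap' : 0 < Δ - ε := by linarith
  have hlamr := eigenvalue_nonneg hK hV heig ⟨r, hrN⟩
  have hlampos : 0 < lam ⟨r - 1, by omega⟩ := by
    have h := mul_pos hΔ0 hNpos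
    rw [hΔ, div_mul_cancel₀ _ hNpos.ne'] at h
    linarith
  have hle : ∀ j : Fin r, lam ⟨r - 1, by omega⟩ ≤ lam (Fin.castLE hrN.le j) := fun j =>
    hdesc _ _ (Fin.mk_le_mk.mpr (by omega))
  have hleh : ∀ k : Fin r, lamh ⟨r - 1, by omega⟩ ≤ lamh (Fin.castLE hrm k) := fun k =>
    hdesch _ _ (Fin.mk_le_mk.mpr (by omega))
  have hpos : ∀ j : Fin r, 0 < lam (Fin.castLE hrN.le j) := fun j => hlampos.trans_le (hle j)
  have hposh : ∀ k : Fin r, 0 < lamh (Fin.castLE hrm k) := fun k => hlamh.trans_le (hleh k)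
  have hφ := phiVec_orthonormal hK hV heig hrN.le hpos
  have hψ := phiVec_orthonormal hKhat hU heigh hrm hposh
  have hsymm : ∀ x y, ⟪(integralOp v - integralOp w) x, y⟫ =
      ⟪x, (integralOp v - integralOp w) y⟫ := fun x y => by
    simp only [_root_.sub_apply, inner_sub_left, inner_sub_right,
      integralOp_symm]
  have hsummable := summable_norm_integralOp_sub_sq b v w
  have hgapΔ : lam ⟨r - 1, by omega⟩ / N - lam ⟨r, hrN⟩ / N - ε = Δ - ε := by rw [hΔ, sub_div]
  have hdk := sum_norm_orthoResidual_le (A := integralOp v) (B := integralOp w) hψ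
    (integralOp_symm w) (fun j => integralOp_phiVec hK heig _)
    (fun k => integralOp_phiVec hKhat heigh _)
    (α := lam ⟨r - 1, by omega⟩ / N) (β := lam ⟨r, hrN⟩ / N)
    (γ := lamh ⟨r - 1, by omega⟩ / m) (ε := ε)
    (fun j => div_le_div_of_nonneg_right (hle j) hNpos.le)
    (fun k => div_le_div_of_nonneg_right (hleh k) (Nat.cast_nonneg m))
    (fun x hx => inner_integralOp_le_of_orthogonal hKhat hU heigh hrm hposh
      (fun k hk => hdesch _ _ (Fin.mk_le_mk.mpr (by omega))) hlamh.le hx)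
    (fun x hx => inner_integralOp_le_of_orthogonal hK hV heig hrN.le hpos
      (fun k hk => hdesc _ _ (Fin.mk_le_mk.mpr hk)) hlamr hx)
    (fun x => hε ▸ norm_apply_le_hsNorm b hsymm hsummable x)
    (by rw [hgapΔ]; exact hgap'.le)
  replace hdk := hdk.trans (sum_norm_apply_sq_le_hsNorm_sq b hsymm hsummable hφ)
  rw [hgapΔ, ← hε] at hdk
  set S := ∑ j : Fin r, ‖orthoResidual (fun k : Fin r => phiVec w lamh U (Fin.castLE hrm k))
    (phiVec v lam V (Fin.castLE hrN.le j))‖ ^ 2 with hS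
  have hsqrt : Real.sqrt S ≤ ε / (Δ - ε) := by
    refine Real.sqrt_le_iff.mpr ⟨by positivity, ?_⟩
    rw [div_pow, le_div_iff₀ (by positivity)]
    linarith
  have hKt : Kᵀ = K := by
    ext i j
    rw [transpose_apply, hK, hK, real_inner_comm]
  constructor
  · refine (frobNorm_le_of_abs_le (c := 2 * (ε / (Δ - ε))) (by positivity) fun i j => ?_).trans ?_
    · have h1 := mul_rankW_mul_transpose_apply lam V hrN.le hpos v v hK i j
      rw [hKt] at h1
      rw [Matrix.sub_apply, h1, mul_rankW_mul_transpose_apply lamh U hrm hposh v w hKb i j]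
      refine (abs_sub_projection_form_le hφ hψ (hv i) (hv j)).trans ?_
      exact mul_le_mul_of_nonneg_left hsqrt zero_le_two
    · have h : 0 ≤ N * (ε / (Δ - ε)) := by positivity
      calc (N : ℝ) * (2 * (ε / (Δ - ε))) = 2 * (N * (ε / (Δ - ε))) := by ring
        _ ≤ 4 * (N * (ε / (Δ - ε))) := by linarith
        _ = _ := by ring
  · rw [div_le_div_iff₀ hgap' hΔ0]
    have h : 0 ≤ (N : ℝ) * ε := by positivity
    nlinarith
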